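/- For every n ≡ 0 or 2 (mod 6), the number of triangular faces in any arrangement of n lines in the plane is at most ⌊n(n-2)/3⌋. -/

import Mathlib

/-- A straight line in the plane, as a subset of `ℝ × ℝ`. -/
def IsLine (L : Set (ℝ × ℝ)) : Prop :=
  ∃ a b c : ℝ, (a, b) ≠ (0, 0) ∧ L = {p : ℝ × ℝ | a * p.1 + b * p.2 = c}

/-- `F` is a bounded triangular face of the arrangement of lines `A`:
a connected component of the complement of the union of the lines which is
bounded and whose closure is a (nondegenerate) triangle. -/
def IsTriangularFace (A : Finset (Set (ℝ × ℝ))) (F : Set (ℝ × ℝ)) : Prop :=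
  (∃ p ∈ (⋃ L ∈ A, L)ᶜ, F = connectedComponentIn (⋃ L ∈ A, L)ᶜ p) ∧
    Bornology.IsBounded F ∧
    ∃ p q r : ℝ × ℝ, ¬ Collinear ℝ ({p, q, r} : Set (ℝ × ℝ)) ∧
      closure F = convexHull ℝ ({p, q, r} : Set (ℝ × ℝ))

namespace LineArrangement

/-- Twice the signed area of the triangle `p q r`. -/
def area (p q r : ℝ × ℝ) : ℝ :=
  (q.1 - p.1) * (r.2 - p.2) - (q.2 - p.2) * (r.1 - p.1)

theorem area_rotate (p q r : ℝ × ℝ) : area q r p = area p q r := by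
  unfold area; ring

theorem area_swap (p q r : ℝ × ℝ) : area q p r = -area p q r := by
  unfold area; ring

theorem area_swap_right (p q r : ℝ × ℝ) : area p r q = -area p q r := by
  unfold area; ring

@[simp] theorem area_self_left (p q : ℝ × ℝ) : area p p q = 0 := by
  unfold area; ring

@[simp] theorem area_self_right (p q : ℝ × ℝ) : area p q q = 0 := by
  unfold area; ring

@[simp] theorem area_self_outer (p q : ℝ × ℝ) : area p q p = 0 := by
  unfold area; ring

/-- The point with parameter `t` on the line through `c` and `x`. -/
def linePoint (c x : ℝ × ℝ) (t : ℝ) : ℝ × ℝ :=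
  (c.1 + t * (x.1 - c.1), c.2 + t * (x.2 - c.2))

theorem area_linePoint (p c x : ℝ × ℝ) (s t : ℝ) :
    area p (linePoint c x s) (linePoint c x t) = (t - s) * area p c x := by
  unfold area linePoint; ring

/-- The point `y` lies strictly beyond `o` on the ray from `x` through `o`. -/
def Beyond (x o y : ℝ × ℝ) : Prop :=
  ∃ k > 0, y = linePoint o x (-k)

theorem Beyond.symm {x o y : ℝ × ℝ} (h : Beyond x o y) : Beyond y o x := by
  obtain ⟨k, hk, rfl⟩ := h
  refine ⟨k⁻¹, by positivity, ?_⟩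
  ext <;> simp only [linePoint] <;> field_simp <;> ring

theorem Beyond.area_left {x o y : ℝ × ℝ} (h : Beyond x o y) :
    ∃ k > 0, ∀ s, area s o y = -k * area s o x := by
  obtain ⟨k, hk, rfl⟩ := h
  exact ⟨k, hk, fun s => by unfold area linePoint; ring⟩

theorem Beyond.area_outer {x o y : ℝ × ℝ} (h : Beyond x o y) :
    ∃ k > 1, ∀ s, area s x y = k * area s x o := by
  obtain ⟨k, hk, rfl⟩ := h
  exact ⟨1 + k, by linarith, fun s => by unfold area linePoint; ring⟩

theorem exists_linePoint {o x y : ℝ × ℝ} (hx : x ≠ o) (h : area o x y = 0) :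
    ∃ t, y = linePoint o x t := by
  by_cases h1 : x.1 = o.1
  · have h2 : x.2 - o.2 ≠ 0 := fun h2 => hx (Prod.ext h1 (by linarith))
    refine ⟨(y.2 - o.2) / (x.2 - o.2), ?_⟩
    unfold area at h
    rw [h1, sub_self, zero_mul, zero_sub, neg_eq_zero] at h
    have h3 := (mul_eq_zero.1 h).resolve_left h2
    ext <;> simp only [linePoint]
    · rw [h1]; linarith
    · field_simp; ring
  · have h2 : x.1 - o.1 ≠ 0 := sub_ne_zero.2 h1
    refine ⟨(y.1 - o.1) / (x.1 - o.1), ?_⟩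
    unfold area at h
    ext <;> simp only [linePoint] <;> field_simp
    · ring
    · linarith

theorem beyond_of_area {s o x y : ℝ × ℝ} (h : area o x y = 0)
    (hs : area s o x * area s o y < 0) : Beyond x o y := by
  have hx : x ≠ o := by rintro rfl; simp at hs
  obtain ⟨t, rfl⟩ := exists_linePoint hx h
  refine ⟨-t, ?_, by rw [neg_neg]⟩
  have : area s o (linePoint o x t) = t * area s o x := by unfold area linePoint; ring
  rw [this] at hs
  by_contra hc
  nlinarith [mul_nonneg (by linarith : (0:ℝ) ≤ t) (mul_self_nonneg (area s o x))]

theorem Beyond.trichotomy {x o y z : ℝ × ℝ} (hy : Beyond x o y) (hz : Beyond x o z) :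
    y = z ∨ Beyond o y z ∨ Beyond o z y := by
  obtain ⟨k, hk, rfl⟩ := hy
  obtain ⟨l, hl, rfl⟩ := hz
  rcases lt_trichotomy k l with h | h | h
  · refine Or.inr (Or.inl ⟨(l - k) / k, div_pos (by linarith) hk, ?_⟩)
    ext <;> simp only [linePoint] <;> field_simp <;> ring
  · exact Or.inl (by rw [h])
  · refine Or.inr (Or.inr ⟨(k - l) / l, div_pos (by linarith) hl, ?_⟩)
    ext <;> simp only [linePoint] <;> field_simp <;> ring

theorem isLine_mem_iff {L : Set (ℝ × ℝ)} (hL : IsLine L) {p q : ℝ × ℝ} (hp : p ∈ L)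
    (hq : q ∈ L) (hpq : p ≠ q) (r : ℝ × ℝ) : r ∈ L ↔ area p q r = 0 := by
  obtain ⟨a, b, c, hab, rfl⟩ := hL
  simp only [Set.mem_ofPred_eq] at hp hq ⊢
  have hab' : a ≠ 0 ∨ b ≠ 0 := by
    by_contra! h; exact hab (by rw [h.1, h.2])
  constructor
  · intro hr
    unfold area
    rcases hab' with h | h
    · apply mul_left_cancel₀ h; linear_combination (r.2 - p.2) * (hq - hp) - (q.2 - p.2) * (hr - hp)
    · apply mul_left_cancel₀ h; linear_combination (q.1 - p.1) * (hr - hp) - (r.1 - p.1) * (hq - hp)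
  · intro h
    obtain ⟨t, rfl⟩ := exists_linePoint hpq.symm h
    simp only [linePoint]
    linear_combination (1 - t) * hp + t * hq

variable {A : Finset (Set (ℝ × ℝ))}

/-- Some line of the arrangement passes through both `p` and `q`. -/
def Joined (A : Finset (Set (ℝ × ℝ))) (p q : ℝ × ℝ) : Prop :=
  ∃ L ∈ A, p ∈ L ∧ q ∈ L

theorem Joined.symm {p q : ℝ × ℝ} (h : Joined A p q) : Joined A q p := by
  obtain ⟨L, hL, hp, hq⟩ := h; exact ⟨L, hL, hq, hp⟩

theorem Joined.trans_area (hA : ∀ L ∈ A, IsLine L) {p q r : ℝ × ℝ} (h : Joined A p q)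
    (hpq : p ≠ q) (hr : area p q r = 0) : Joined A p r := by
  obtain ⟨L, hL, hp, hq⟩ := h
  exact ⟨L, hL, hp, (isLine_mem_iff (hA L hL) hp hq hpq r).2 hr⟩

theorem Beyond.area_eq_zero {x o y : ℝ × ℝ} (h : Beyond x o y) : area x o y = 0 := by
  obtain ⟨k, hk, rfl⟩ := h
  unfold area linePoint; ring

open Classical in
/-- The number of lines of the arrangement through `p`. -/
noncomputable def mult (A : Finset (Set (ℝ × ℝ))) (p : ℝ × ℝ) : ℕ :=
  (A.filter (fun L => p ∈ L)).card

theorem le_mult (hA : ∀ L ∈ A, IsLine L) {p : ℝ × ℝ} {ι : Type*} (s : Finset ι)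
    (f : ι → ℝ × ℝ) (hf : ∀ i ∈ s, Joined A p (f i))
    (hd : ∀ i ∈ s, ∀ j ∈ s, i ≠ j → area p (f i) (f j) ≠ 0) : s.card ≤ mult A p := by
  classical
  unfold mult
  refine Finset.card_le_card_of_forall_subsingleton (fun i L => f i ∈ L) ?_ ?_
  · intro i hi
    obtain ⟨L, hL, hp, hq⟩ := hf i hi
    exact ⟨L, Finset.mem_filter.2 ⟨hL, hp⟩, hq⟩
  · intro L hL i hi j hj
    rw [Finset.mem_filter] at hL
    by_contra hij
    have hne := hd i hi.1 j hj.1 hij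
    have hpi : p ≠ f i := by
      intro h; rw [← h] at hne; simp at hne
    exact hne ((isLine_mem_iff (hA L hL.1) hL.2 hi.2 hpi _).1 hj.2)

theorem three_le_mult (hA : ∀ L ∈ A, IsLine L) {p x y z : ℝ × ℝ} (hx : Joined A p x)
    (hy : Joined A p y) (hz : Joined A p z) (hxy : area p x y ≠ 0) (hxz : area p x z ≠ 0)
    (hyz : area p y z ≠ 0) : 3 ≤ mult A p := by
  have h := le_mult hA (p := p) (Finset.univ : Finset (Fin 3)) ![x, y, z] ?_ ?_
  · simpa using h
  · intro i _; fin_cases i <;> assumption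
  · intro i _ j _ hij
    fin_cases i <;> fin_cases j <;>
      first
      | exact absurd rfl hij
      | assumption
      | (rw [Ne, area_swap_right, neg_eq_zero]; assumption)

theorem four_le_mult (hA : ∀ L ∈ A, IsLine L) {p x y z w : ℝ × ℝ} (hx : Joined A p x)
    (hy : Joined A p y) (hz : Joined A p z) (hw : Joined A p w) (hxy : area p x y ≠ 0)
    (hxz : area p x z ≠ 0) (hxw : area p x w ≠ 0)
    (hyz : area p y z ≠ 0) (hyw : area p y w ≠ 0) (hzw : area p z w ≠ 0) : 4 ≤ mult A p := by
  have h := le_mult hA (p := p) (Finset.univ : Finset (Fin 4)) ![x, y, z, w] ?_ ?_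
  · simpa using h
  · intro i _; fin_cases i <;> assumption
  · intro i _ j _ hij
    fin_cases i <;> fin_cases j <;>
      first
      | exact absurd rfl hij
      | assumption
      | (rw [Ne, area_swap_right, neg_eq_zero]; assumption)

theorem card_le_mult_of_linePoint (hA : ∀ L ∈ A, IsLine L) {p c x : ℝ × ℝ}
    (h : area p c x ≠ 0) (s : Finset ℝ) (hs : ∀ t ∈ s, Joined A p (linePoint c x t)) :
    s.card ≤ mult A p :=
  le_mult hA s (linePoint c x) hs fun i _ j _ hij => by
    rw [area_linePoint]
    exact mul_ne_zero (sub_ne_zero.2 hij.symm) h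

/-- The points `p`, `q`, `r` are the vertices of a triangular cell of the arrangement. -/
structure Tri (A : Finset (Set (ℝ × ℝ))) (p q r : ℝ × ℝ) : Prop where
  area_ne : area p q r ≠ 0
  joined₁ : Joined A p q
  joined₂ : Joined A q r
  joined₃ : Joined A r p
  sep₁ : ∀ s t, s ≠ t → Joined A s t → 0 ≤ area s t p * area s t q
  sep₂ : ∀ s t, s ≠ t → Joined A s t → 0 ≤ area s t q * area s t r
  sep₃ : ∀ s t, s ≠ t → Joined A s t → 0 ≤ area s t r * area s t p

namespace Tri

variable {x y z w a b u v p q r : ℝ × ℝ}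

theorem rotate (h : Tri A p q r) : Tri A q r p :=
  ⟨by rw [area_rotate]; exact h.area_ne, h.joined₂, h.joined₃, h.joined₁, h.sep₂, h.sep₃, h.sep₁⟩

theorem swap (h : Tri A p q r) : Tri A q p r :=
  ⟨by rw [area_swap, neg_ne_zero]; exact h.area_ne, h.joined₁.symm, h.joined₃.symm,
    h.joined₂.symm, fun s t h1 h2 => by rw [mul_comm]; exact h.sep₁ s t h1 h2,
    fun s t h1 h2 => by rw [mul_comm]; exact h.sep₃ s t h1 h2,
    fun s t h1 h2 => by rw [mul_comm]; exact h.sep₂ s t h1 h2⟩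

theorem swap_right (h : Tri A p q r) : Tri A p r q := h.swap.rotate

theorem ne₁ (h : Tri A p q r) : p ≠ q := by
  rintro rfl; exact h.area_ne (area_self_left _ _)

theorem ne₂ (h : Tri A p q r) : q ≠ r := h.rotate.ne₁

theorem ne₃ (h : Tri A p q r) : r ≠ p := h.rotate.rotate.ne₁

theorem eq_of_same_side (h : Tri A x y z) (h' : Tri A x y w)
    (hs : 0 < area x y z * area x y w) : z = w := by
  have e1 := h.sep₁ x w h'.ne₃.symm h'.joined₃.symm
  have f1 := h'.sep₁ x z h.ne₃.symm h.joined₃.symm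
  have e1' := h.sep₂ x w h'.ne₃.symm h'.joined₃.symm
  have f1' := h'.sep₂ x z h.ne₃.symm h.joined₃.symm
  have e2' := h.sep₃ y w h'.ne₂ h'.joined₂
  have f2' := h'.sep₃ y z h.ne₂ h.joined₂
  rw [area_swap_right x y w] at e1'
  rw [area_swap_right x y z, area_swap_right x w z] at f1'
  rw [← area_rotate y w x, ← area_rotate w x y] at e2'
  rw [← area_rotate y z x, ← area_rotate z x y, area_swap_right y w z] at f2'
  have hx : area x w z = 0 := by
    by_contra hne
    have := mul_self_pos.2 hne
    have h1 : 0 ≤ (-area x y w * area x w z) * (-area x y z * -area x w z) := mul_nonneg e1' f1'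
    nlinarith [mul_pos hs this]
  have hy : area y w z = 0 := by
    by_contra hne
    have := mul_self_pos.2 hne
    have h1 := mul_nonneg e2' f2'
    nlinarith [mul_pos hs this]
  by_contra hzw
  apply h.area_ne
  obtain ⟨t, ht⟩ := exists_linePoint (o := z) (x := w) (y := x) (Ne.symm hzw)
    (by rw [area_rotate, area_swap_right, hx, neg_zero])
  obtain ⟨s, hs'⟩ := exists_linePoint (o := z) (x := w) (y := y) (Ne.symm hzw)
    (by rw [area_rotate, area_swap_right, hy, neg_zero])
  rw [ht, hs']
  unfold area linePoint
  ring

theorem opposite_sides (h : Tri A x y z) (h' : Tri A x y w) (hne : z ≠ w) :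
    area x y z * area x y w < 0 := by
  by_contra hc
  exact hne (h.eq_of_same_side h' (lt_of_le_of_ne (not_lt.1 hc)
    (mul_ne_zero h.area_ne h'.area_ne).symm))

theorem eq_or_eq (h : Tri A x y z) (h' : Tri A x y w) (h'' : Tri A x y v) (hne : z ≠ w) :
    v = z ∨ v = w := by
  by_contra! hc
  have h1 := h.opposite_sides h' hne
  have h2 := h.opposite_sides h'' hc.1.symm
  have h3 := h'.opposite_sides h'' hc.2.symm
  nlinarith [mul_pos_of_neg_of_neg h1 h2, mul_self_nonneg (area x y z)]

theorem other_unique (h : Tri A x y z) (h' : Tri A x y w) (h'' : Tri A x y v) (hw : w ≠ z)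
    (hv : v ≠ z) : w = v :=
  ((h.eq_or_eq h' h'' hw.symm).resolve_left hv).symm

theorem not_beyond (h : Tri A x y z) (h' : Tri A x u w) : ¬ Beyond x y u := by
  intro hb
  obtain ⟨k, hk, e⟩ := hb.area_left
  have h1 := h'.sep₁ y z h.ne₂ h.joined₂
  have e1 : area y z u = -k * area y z x := by
    have := e z
    rw [area_swap y z u, area_swap y z x] at this
    linarith
  rw [e1] at h1
  have : 0 < area y z x * area y z x := mul_self_pos.2 h.rotate.area_ne
  nlinarith

theorem beyond_of_mult_two (hA : ∀ L ∈ A, IsLine L) (ha : mult A a = 2) (h : Tri A a x y)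
    (h' : Tri A a x w) (hne : w ≠ y) : Beyond y a w := by
  have h0 : area a y w = 0 := by
    by_contra hc
    have := three_le_mult hA h.joined₁ h.joined₃.symm h'.joined₃.symm h.area_ne h'.area_ne hc
    omega
  have hs := h.opposite_sides h' hne.symm
  rw [area_swap x a y, area_swap x a w] at hs
  exact beyond_of_area (s := x) h0 (by linarith)

theorem two_le_mult (hA : ∀ L ∈ A, IsLine L) (h : Tri A p q r) : 2 ≤ mult A p := by
  have := le_mult hA (p := p) (Finset.univ : Finset (Fin 2)) ![q, r] ?_ ?_
  · simpa using this
  · intro i _; fin_cases i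
    · exact h.joined₁
    · exact h.joined₃.symm
  · intro i _ j _ hij
    fin_cases i <;> fin_cases j
    · exact absurd rfl hij
    · exact h.area_ne
    · exact h.swap_right.area_ne
    · exact absurd rfl hij

theorem mult_ne_two_of_double (hA : ∀ L ∈ A, IsLine L) (h : Tri A x y z) (h' : Tri A x y w)
    (hne : w ≠ z) (hx : mult A x = 2) : mult A y ≠ 2 := by
  intro hy
  have h1 := beyond_of_mult_two hA hx h h' hne
  have h2 := beyond_of_mult_two hA hy h.swap h'.swap hne
  obtain ⟨k, hk, e⟩ := h1.area_outer
  obtain ⟨l, hl, e'⟩ := h2.area_outer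
  apply h.area_ne
  have a1 := e y
  have a2 := e' y
  have a3 : area y z y = 0 := by simp
  rw [a3, mul_zero] at a2
  rw [a2] at a1
  have : area y z x = 0 := by
    rcases mul_eq_zero.1 a1.symm with h | h
    · linarith
    · exact h
  rw [← area_rotate, this]

/-- At a point of multiplicity three, two neighbouring edges that both lead to points of
multiplicity two are not both shared by two triangular cells. -/
theorem not_both_double (hA : ∀ L ∈ A, IsLine L) (hp : mult A p = 3) (ha : mult A a = 2)
    (hb : mult A b = 2) (h : Tri A p a b) (hw : Tri A p a w) (hwb : w ≠ b)
    (hv : Tri A p b v) : v = a := by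
  by_contra hva
  obtain ⟨k, hk, rfl⟩ := beyond_of_mult_two hA ha h.swap hw.swap hwb
  obtain ⟨l, hl, rfl⟩ := beyond_of_mult_two hA hb h.swap_right.swap hv.swap hva
  have := card_le_mult_of_linePoint hA h.area_ne {0, 1, -k, 1 + l} ?_
  · rw [Finset.card_insert_of_notMem, Finset.card_insert_of_notMem,
      Finset.card_insert_of_notMem, Finset.card_singleton] at this
    · omega
    · simp; linarith
    · simp; constructor <;> linarith
    · simp; refine ⟨?_, ?_⟩ <;> linarith
  · have e : linePoint a b (1 + l) = linePoint b a (-l) := by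
      ext <;> simp only [linePoint] <;> ring
    intro t ht
    simp only [Finset.mem_insert, Finset.mem_singleton] at ht
    rcases ht with rfl | rfl | rfl | rfl
    · simpa [linePoint] using h.joined₁
    · simpa [linePoint] using h.joined₃.symm
    · exact hw.joined₃.symm
    · rw [e]; exact hv.joined₃.symm

/-- Prolongation at a point `x` of multiplicity three whose lines are `xa`, `xy`, `xy'`. -/
theorem beyond_of_mult_three {y' : ℝ × ℝ} (hA : ∀ L ∈ A, IsLine L) (hx : mult A x = 3)
    (h : Tri A x y a) (h' : Tri A x a y') (hb : Beyond y a y') (hw : Tri A x y w)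
    (hwa : w ≠ a) : Beyond y' x w := by
  obtain ⟨k, hk, e⟩ := hb.area_left
  obtain ⟨k', hk', e'⟩ := hb.area_outer
  have hs := h.opposite_sides hw hwa.symm
  have hyy : area x y y' ≠ 0 := by
    rw [e']; exact mul_ne_zero (by linarith) h.area_ne
  have hd : area x a w = 0 ∨ area x y' w = 0 := by
    by_contra! hc
    have := four_le_mult hA h.joined₁ h.joined₃.symm h'.joined₃.symm hw.joined₃.symm h.area_ne
      hyy hw.area_ne h'.area_ne hc.1 hc.2
    omega
  rcases hd with hd | hd
  · exfalso
    obtain ⟨l, hl, el⟩ := (beyond_of_area (s := y) hd (by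
      rw [area_swap y x a, area_swap y x w] at *; linarith)).area_left
    have h1 := hw.sep₂ x y' h'.ne₃.symm h'.joined₃.symm
    have e1 : area x y' y = -(k' * area x y a) := by rw [area_swap_right, e']
    have e2 : area x y' w = l * (k * area x y a) := by
      have h2 := el y'
      have h4 := e x
      rw [area_swap x y' w, area_swap x y' a, area_swap_right x a y'] at h2
      rw [h4, area_swap_right x y a] at h2
      linarith
    rw [e1, e2] at h1
    have h2 : 0 < k' * l * k := by positivity
    have h3 := mul_self_pos.2 h.area_ne
    nlinarith [mul_pos h2 h3]
  · refine beyond_of_area (s := y) hd ?_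
    rw [area_swap x y y', area_swap x y w, e']
    nlinarith

end Tri

/-- The edge `x y` is shared by two triangular cells. -/
def Dbl (A : Finset (Set (ℝ × ℝ))) (x y : ℝ × ℝ) : Prop :=
  ∃ z w, z ≠ w ∧ Tri A x y z ∧ Tri A x y w

theorem Dbl.symm {x y : ℝ × ℝ} (h : Dbl A x y) : Dbl A y x := by
  obtain ⟨z, w, hne, hz, hw⟩ := h
  exact ⟨z, w, hne, hz.swap, hw.swap⟩

theorem dbl_comm (x y : ℝ × ℝ) : Dbl A x y ↔ Dbl A y x := ⟨Dbl.symm, Dbl.symm⟩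

theorem Dbl.exists_ne {x y : ℝ × ℝ} (h : Dbl A x y) (z : ℝ × ℝ) : ∃ w ≠ z, Tri A x y w := by
  obtain ⟨u, w, hne, hu, hw⟩ := h
  by_cases huz : u = z
  · exact ⟨w, by rintro rfl; exact hne huz, hw⟩
  · exact ⟨u, huz, hu⟩

/-- A point `a` at which two lines cross, surrounded by four triangular cells with outer
vertices `x`, `y`, `x'`, `y'` in cyclic order. -/
structure Cross (A : Finset (Set (ℝ × ℝ))) (a x y x' y' : ℝ × ℝ) : Prop where
  tri₁ : Tri A a x y
  tri₂ : Tri A a y x'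
  tri₃ : Tri A a x' y'
  tri₄ : Tri A a y' x
  beyond₁ : Beyond x a x'
  beyond₂ : Beyond y a y'

namespace Cross

variable {a x y x' y' w w' q : ℝ × ℝ}

theorem rotate (h : Cross A a x y x' y') : Cross A a y x' y' x :=
  ⟨h.tri₂, h.tri₃, h.tri₄, h.tri₁, h.beyond₂, h.beyond₁.symm⟩

theorem reflect (h : Cross A a x y x' y') : Cross A a y x y' x' :=
  ⟨h.tri₁.swap_right, h.tri₄.swap_right, h.tri₃.swap_right, h.tri₂.swap_right, h.beyond₂, h.beyond₁⟩

theorem beyond_of_mult (hA : ∀ L ∈ A, IsLine L) (h : Cross A a x y x' y') (hx : mult A x = 3)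
    (hw : Tri A x y w) (hwa : w ≠ a) : Beyond y' x w :=
  Tri.beyond_of_mult_three hA hx h.tri₁.rotate h.tri₄.rotate.rotate h.beyond₂ hw hwa

/-- The four outer vertices are not all of multiplicity three when two opposite outer edges
are shared. -/
theorem not_all_three (hA : ∀ L ∈ A, IsLine L) (h : Cross A a x y x' y') (hx : mult A x = 3)
    (hy : mult A y = 3) (hx' : mult A x' = 3) (hy' : mult A y' = 3) (hw : Tri A x y w)
    (hwa : w ≠ a) (hw' : Tri A x' y' w') (hwa' : w' ≠ a) : False := by
  have hne : area x y y' ≠ 0 := by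
    obtain ⟨k, hk, e⟩ := h.beyond₂.area_outer
    rw [e]
    exact mul_ne_zero (by linarith) h.tri₁.rotate.area_ne
  obtain ⟨k₁, hk₁, e₁⟩ := h.beyond_of_mult hA hx hw hwa
  obtain ⟨l₁, hl₁, e₂⟩ := h.reflect.beyond_of_mult hA hy hw.swap hwa
  obtain ⟨l₂, hl₂, e₃⟩ := h.rotate.rotate.beyond_of_mult hA hx' hw' hwa'
  obtain ⟨k₂, hk₂, e₄⟩ := h.rotate.rotate.reflect.beyond_of_mult hA hy' hw'.swap hwa'
  rw [e₁] at e₂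
  rw [e₃] at e₄
  simp only [linePoint, Prod.ext_iff] at e₂ e₄
  have hL : (1 + l₁ + l₂) ≠ 0 := by positivity
  apply hne
  apply mul_left_cancel₀ hL
  unfold area
  have f₁ : (1 + l₁ + l₂) * (y.1 - x'.1) = (1 + k₁ + k₂) * (x.1 - y'.1) := by
    linear_combination -e₄.1 - e₂.1
  have f₂ : (1 + l₁ + l₂) * (y.2 - x'.2) = (1 + k₁ + k₂) * (x.2 - y'.2) := by
    linear_combination -e₄.2 - e₂.2
  have g₁ : (1 + l₁ + l₂) * (y.1 - x.1) =
      ((1 + l₁ + l₂) * k₁ - l₁ * (1 + k₁ + k₂)) * (x.1 - y'.1) := by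
    linear_combination -l₁ * f₁ - (1 + l₁ + l₂) * e₂.1
  have g₂ : (1 + l₁ + l₂) * (y.2 - x.2) =
      ((1 + l₁ + l₂) * k₁ - l₁ * (1 + k₁ + k₂)) * (x.2 - y'.2) := by
    linear_combination -l₁ * f₂ - (1 + l₁ + l₂) * e₂.2
  linear_combination (y'.2 - x.2) * g₁ - (y'.1 - x.1) * g₂

end Cross

/-- The point `q` is the last point joined to `p` on the line `c q`, in the direction from `c`
to `q`, while some point on the other side of `c` is joined to `p`. -/
def LastJoined (A : Finset (Set (ℝ × ℝ))) (p c q : ℝ × ℝ) : Prop :=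
  (∃ x, Beyond x c q ∧ Joined A p x) ∧ ¬ ∃ y, Beyond c q y ∧ Joined A p y

theorem LastJoined.not_swap {p c q : ℝ × ℝ} (h : LastJoined A p c q) :
    ¬ LastJoined A p q c := by
  rintro ⟨⟨x, hx, hj⟩, -⟩
  exact h.2 ⟨x, hx.symm, hj⟩

theorem LastJoined.not_dbl (hA : ∀ L ∈ A, IsLine L) {p c q : ℝ × ℝ} (h : LastJoined A p c q)
    (ht : Tri A p c q) (hq : mult A q = 2) : ¬ Dbl A p q := by
  intro hd
  obtain ⟨w, hwc, hw⟩ := hd.exists_ne c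
  exact h.2 ⟨w, Tri.beyond_of_mult_two hA hq ht.rotate.rotate hw.swap hwc, hw.joined₃.symm⟩

theorem Cross.lastJoined (hA : ∀ L ∈ A, IsLine L) {a x y p c w q : ℝ × ℝ}
    (h : Cross A a x y p c) (hx : mult A x = 3) (hy : mult A y = 3) (hp : mult A p = 4)
    (hc : mult A c = 3) (hw : Tri A x y w) (hwa : w ≠ a) (hq : Tri A p c q) (hqa : q ≠ a) :
    LastJoined A p c q := by
  have hb : Beyond x c q := h.rotate.rotate.reflect.beyond_of_mult hA hc hq.swap hqa
  have hpx : Joined A p x := h.tri₃.joined₁.symm.trans_area hA h.tri₃.ne₁.symm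
    h.beyond₁.symm.area_eq_zero
  refine ⟨⟨x, hb, hpx⟩, ?_⟩
  rintro ⟨y₀, hy₀, hj⟩
  have hcx : Beyond c x w := h.beyond_of_mult hA hx hw hwa
  have hpy : Beyond p y w := h.reflect.beyond_of_mult hA hy hw.swap hwa
  have hpw : Joined A p w := h.tri₂.joined₂.symm.trans_area hA h.tri₂.ne₂.symm hpy.area_eq_zero
  have hne : area p c x ≠ 0 := by
    obtain ⟨k, hk, e⟩ := h.beyond₁.area_outer
    rw [area_rotate x p c, area_rotate c x p, e]
    exact mul_ne_zero (by linarith) (h.tri₄.rotate.area_ne)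
  obtain ⟨k, hk, rfl⟩ := hb
  obtain ⟨l, hl, rfl⟩ := hcx
  obtain ⟨j, hj0, rfl⟩ := hy₀
  have := card_le_mult_of_linePoint hA hne {0, 1, -k, 1 + l, -k - j * k} ?_
  · have hjk : 0 < j * k := by positivity
    rw [Finset.card_insert_of_notMem, Finset.card_insert_of_notMem,
      Finset.card_insert_of_notMem, Finset.card_insert_of_notMem, Finset.card_singleton] at this
    · omega
    · simp; intro h; linarith
    · simp; constructor
      · intro h; linarith
      · intro h; linarith
    · simp; refine ⟨?_, ?_, ?_⟩ <;> intro h <;> linarith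
    · simp; refine ⟨?_, ?_, ?_⟩ <;> intro h <;> linarith
  · have e₁ : linePoint c x (1 + l) = linePoint x c (-l) := by
      ext <;> simp only [linePoint] <;> ring
    have e₂ : linePoint c x (-k - j * k) = linePoint (linePoint c x (-k)) c (-j) := by
      ext <;> simp only [linePoint] <;> ring
    intro t ht
    simp only [Finset.mem_insert, Finset.mem_singleton] at ht
    rcases ht with rfl | rfl | rfl | rfl | rfl
    · simpa [linePoint] using hq.joined₁
    · simpa [linePoint] using hpx
    · exact hq.joined₃.symm
    · rw [e₁]; exact hpw
    · rw [e₂]; exact hj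

open Classical in
/-- The weight of an edge. -/
noncomputable def edgeWeight (A : Finset (Set (ℝ × ℝ))) (x y : ℝ × ℝ) : ℤ :=
  if Dbl A x y then mult A x + mult A y - 6 else 2 * (mult A x + mult A y - 4)

theorem edgeWeight_comm (x y : ℝ × ℝ) : edgeWeight A x y = edgeWeight A y x := by
  unfold edgeWeight
  rw [dbl_comm x y, add_comm (mult A x : ℤ)]

/-- The total weight of the edges of a triangle. -/
noncomputable def weight (A : Finset (Set (ℝ × ℝ))) (x y z : ℝ × ℝ) : ℤ :=
  edgeWeight A x y + edgeWeight A y z + edgeWeight A z x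

/-- A triangular cell of negative weight. -/
structure Neg (A : Finset (Set (ℝ × ℝ))) (a x y : ℝ × ℝ) : Prop where
  tri : Tri A a x y
  mult₁ : mult A a = 2
  mult₂ : mult A x = 3
  mult₃ : mult A y = 3
  dbl₁ : Dbl A a x
  dbl₂ : Dbl A x y
  dbl₃ : Dbl A a y

/-- A donor next to a negative cell across one edge. -/
structure DonorOne (A : Finset (Set (ℝ × ℝ))) (a x v : ℝ × ℝ) : Prop where
  tri : Tri A a x v
  mult₁ : mult A a = 2
  mult₂ : mult A x = 3
  dbl : Dbl A a x
  not_dbl : ¬ Dbl A a v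

/-- A donor opposite to a negative cell at a simple crossing. -/
structure DonorTwo (A : Finset (Set (ℝ × ℝ))) (a u v : ℝ × ℝ) : Prop where
  tri : Tri A a u v
  mult₁ : mult A a = 2
  dbl₁ : Dbl A a u
  dbl₂ : Dbl A a v
  weight_ge : 2 ≤ weight A a u v

/-- A donor adjacent to the cell opposite to a negative cell at a simple crossing. -/
structure DonorThree (A : Finset (Set (ℝ × ℝ))) (u v q : ℝ × ℝ) : Prop where
  tri : Tri A u v q
  dbl : Dbl A u v
  last : (mult A u = 4 ∧ mult A v = 3 ∧ LastJoined A u v q) ∨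
    (mult A u = 3 ∧ mult A v = 4 ∧ LastJoined A v u q)

/-- The cells `a x v` and `a y u` are adjacent to the cell `a x y`. -/
structure Flanked (A : Finset (Set (ℝ × ℝ))) (a x y u v : ℝ × ℝ) : Prop where
  tri₁ : Tri A a x v
  ne₁ : v ≠ y
  tri₂ : Tri A a y u
  ne₂ : u ≠ x

theorem Neg.exists_donor (hA : ∀ L ∈ A, IsLine L) {a x y : ℝ × ℝ} (h : Neg A a x y) :
    (∃ v ≠ y, DonorOne A a x v) ∨
    (∃ u v, DonorTwo A a u v ∧ Flanked A a x y u v) ∨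
    (∃ u v q, DonorThree A u v q ∧ q ≠ a ∧ Tri A a u v ∧ Flanked A a x y u v) := by
  obtain ⟨ht, ha, hx, hy, hax, hxy, hay⟩ := h
  obtain ⟨y', hy', ty⟩ := hax.exists_ne y
  obtain ⟨x', hx', tx⟩ := hay.exists_ne x
  obtain ⟨w, hwa, hw⟩ := hxy.exists_ne a
  have hbx : Beyond x a x' := Tri.beyond_of_mult_two hA ha ht.swap_right tx hx'
  have hby : Beyond y a y' := Tri.beyond_of_mult_two hA ha ht ty hy'
  have hf : Flanked A a x y x' y' := ⟨ty, hy', tx, hx'⟩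
  by_cases hT : Tri A a x' y'
  · right
    have hc : Cross A a x y x' y' := ⟨ht, tx, hT, ty.swap_right, hbx, hby⟩
    have hdx : Dbl A a x' := ⟨y, y', hy'.symm, tx.swap_right, hT⟩
    have hdy : Dbl A a y' := ⟨x, x', hx'.symm, ty.swap_right, hT.swap_right⟩
    have mx : mult A x' ≠ 2 := Tri.mult_ne_two_of_double hA hT tx.swap_right hy'.symm ha
    have my : mult A y' ≠ 2 :=
      Tri.mult_ne_two_of_double hA hT.swap_right ty.swap_right hx'.symm ha
    have mx2 := hT.rotate.two_le_mult hA
    have my2 := hT.rotate.rotate.two_le_mult hA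
    by_cases hW : 2 ≤ weight A a x' y'
    · exact Or.inl ⟨x', y', ⟨hT, ha, hdx, hdy, hW⟩, hf⟩
    · right
      have hd : Dbl A x' y' := by
        by_contra hd
        apply hW
        unfold weight edgeWeight
        rw [if_pos hdx, if_neg hd, if_pos hdy.symm]
        omega
      obtain ⟨q, hqa, hq⟩ := hd.exists_ne a
      refine ⟨x', y', q, ⟨hq, hd, ?_⟩, hqa, hT, hf⟩
      have h33 : ¬ (mult A x' = 3 ∧ mult A y' = 3) := fun h =>
        hc.not_all_three hA hx hy h.1 h.2 hw hwa hq hqa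
      have hW' : mult A x' + mult A y' < 8 := by
        by_contra hlt
        apply hW
        unfold weight edgeWeight
        rw [if_pos hdx, if_pos hd, if_pos hdy.symm]
        omega
      have : (mult A x' = 4 ∧ mult A y' = 3) ∨ (mult A x' = 3 ∧ mult A y' = 4) := by omega
      rcases this with ⟨h4, h3⟩ | ⟨h3, h4⟩
      · exact Or.inl ⟨h4, h3, hc.lastJoined hA hx hy h4 h3 hw hwa hq hqa⟩
      · exact Or.inr ⟨h3, h4,
          hc.reflect.lastJoined hA hy hx h4 h3 hw.swap hwa hq.swap hqa⟩
  · left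
    refine ⟨y', hy', ty, ha, hx, hax, fun hd => ?_⟩
    obtain ⟨u, hux, hu⟩ := hd.exists_ne x
    have hbu : Beyond x a u := Tri.beyond_of_mult_two hA ha ty.swap_right hu hux
    rcases hbx.trichotomy hbu with rfl | hb | hb
    · exact hT hu.swap_right
    · exact tx.swap_right.not_beyond hu.swap_right hb
    · exact hu.swap_right.not_beyond tx.swap_right hb

theorem DonorOne.unique {a x y y₁ v : ℝ × ℝ} (hv : DonorOne A a x v) (h : Neg A a x y)
    (h₁ : Neg A a x y₁) (hne : v ≠ y) (hne₁ : v ≠ y₁) : y = y₁ :=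
  hv.tri.other_unique h.tri h₁.tri hne.symm hne₁.symm

theorem Flanked.unique {a x y x₁ y₁ u v : ℝ × ℝ} (ht : Tri A a u v)
    (h : Flanked A a x y u v) (h₁ : Flanked A a x₁ y₁ u v) : x = x₁ ∧ y = y₁ :=
  ⟨ht.swap_right.other_unique h.tri₁.swap_right h₁.tri₁.swap_right h.ne₂.symm h₁.ne₂.symm,
    ht.other_unique h.tri₂.swap_right h₁.tri₂.swap_right h.ne₁.symm h₁.ne₁.symm⟩

open Classical in
/-- The integer indicator of a proposition. -/
noncomputable def ind (P : Prop) : ℤ := if P then 1 else 0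

/-- The weight of the first edge of an ordered triangle, corrected by the discharging. -/
noncomputable def charge (A : Finset (Set (ℝ × ℝ))) (x y z : ℝ × ℝ) : ℤ :=
  edgeWeight A x y + 2 * ind (Neg A x y z) -
    2 * (ind (DonorOne A x y z) + ind (DonorTwo A x y z) + ind (DonorThree A x y z))

/-- The sum of the charges of all orderings of a triangle. -/
noncomputable def totalCharge (A : Finset (Set (ℝ × ℝ))) (x y z : ℝ × ℝ) : ℤ :=
  charge A x y z + charge A y z x + charge A z x y +
    (charge A y x z + charge A x z y + charge A z y x)

theorem totalCharge_rotate (x y z : ℝ × ℝ) : totalCharge A y z x = totalCharge A x y z := by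
  unfold totalCharge; ring

theorem totalCharge_swap (x y z : ℝ × ℝ) : totalCharge A y x z = totalCharge A x y z := by
  unfold totalCharge; ring

theorem charge_eq {x y z : ℝ × ℝ} (h : Tri A x y z) : charge A x y z = edgeWeight A x y +
    2 * ind (mult A x = 2 ∧ mult A y = 3 ∧ mult A z = 3 ∧ Dbl A x y ∧ Dbl A y z ∧ Dbl A x z) -
    2 * (ind (mult A x = 2 ∧ mult A y = 3 ∧ Dbl A x y ∧ ¬ Dbl A x z) +
      ind (mult A x = 2 ∧ Dbl A x y ∧ Dbl A x z ∧
        2 ≤ edgeWeight A x y + edgeWeight A y z + edgeWeight A z x) +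
      ind (Dbl A x y ∧ ((mult A x = 4 ∧ mult A y = 3 ∧ LastJoined A x y z) ∨
        (mult A x = 3 ∧ mult A y = 4 ∧ LastJoined A y x z)))) := by
  have e₁ : Neg A x y z ↔
      (mult A x = 2 ∧ mult A y = 3 ∧ mult A z = 3 ∧ Dbl A x y ∧ Dbl A y z ∧ Dbl A x z) :=
    ⟨fun h => ⟨h.2, h.3, h.4, h.5, h.6, h.7⟩, fun h' => ⟨h, h'.1, h'.2.1, h'.2.2.1,
      h'.2.2.2.1, h'.2.2.2.2.1, h'.2.2.2.2.2⟩⟩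
  have e₂ : DonorOne A x y z ↔ (mult A x = 2 ∧ mult A y = 3 ∧ Dbl A x y ∧ ¬ Dbl A x z) :=
    ⟨fun h => ⟨h.2, h.3, h.4, h.5⟩, fun h' => ⟨h, h'.1, h'.2.1, h'.2.2.1, h'.2.2.2⟩⟩
  have e₃ : DonorTwo A x y z ↔ (mult A x = 2 ∧ Dbl A x y ∧ Dbl A x z ∧
      2 ≤ edgeWeight A x y + edgeWeight A y z + edgeWeight A z x) :=
    ⟨fun h => ⟨h.2, h.3, h.4, h.5⟩, fun h' => ⟨h, h'.1, h'.2.1, h'.2.2.1, h'.2.2.2⟩⟩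
  have e₄ : DonorThree A x y z ↔
      (Dbl A x y ∧ ((mult A x = 4 ∧ mult A y = 3 ∧ LastJoined A x y z) ∨
        (mult A x = 3 ∧ mult A y = 4 ∧ LastJoined A y x z))) :=
    ⟨fun h => ⟨h.2, h.3⟩, fun h' => ⟨h, h'.1, h'.2⟩⟩
  unfold charge
  rw [e₁, e₂, e₃, e₄]

theorem totalCharge_nonneg_of_le (hA : ∀ L ∈ A, IsLine L) {p q r : ℝ × ℝ} (h : Tri A p q r)
    (hpq : mult A p ≤ mult A q) (hqr : mult A q ≤ mult A r) : 0 ≤ totalCharge A p q r := by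
  have hp2 := h.two_le_mult hA
  have n₁ : mult A p = 2 → mult A q = 2 → ¬ Dbl A p q := fun hp hq hd => by
    obtain ⟨w, hne, hw⟩ := hd.exists_ne r
    exact Tri.mult_ne_two_of_double hA h hw hne hp hq
  have n₂ : mult A q = 2 → mult A r = 2 → ¬ Dbl A q r := fun hp hq hd => by
    obtain ⟨w, hne, hw⟩ := hd.exists_ne p
    exact Tri.mult_ne_two_of_double hA h.rotate hw hne hp hq
  have n₃ : mult A p = 2 → mult A r = 2 → ¬ Dbl A p r := fun hp hq hd => by
    obtain ⟨w, hne, hw⟩ := hd.exists_ne q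
    exact Tri.mult_ne_two_of_double hA h.swap_right hw hne hp hq
  have n₄ : mult A r = 3 → mult A p = 2 → mult A q = 2 → Dbl A p r → ¬ Dbl A q r := by
    intro hr hp hq hd hd'
    obtain ⟨w, hne, hw⟩ := hd.symm.exists_ne q
    obtain ⟨v, hne', hv⟩ := hd'.symm.exists_ne p
    exact hne' (Tri.not_both_double hA hr hp hq h.rotate.rotate hw hne hv)
  have n₅ : mult A p = 2 → LastJoined A r q p → ¬ Dbl A p r := fun hp hl hd =>
    hl.not_dbl hA h.rotate.rotate.swap_right hp hd.symm
  have n₆ : LastJoined A r q p → ¬ LastJoined A r p q := fun h => h.not_swap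
  unfold totalCharge
  rw [charge_eq h, charge_eq h.rotate, charge_eq h.rotate.rotate, charge_eq h.swap,
    charge_eq h.swap_right, charge_eq h.swap_right.rotate]
  simp only [dbl_comm q p, dbl_comm r q, dbl_comm r p, edgeWeight_comm q p, edgeWeight_comm r q,
    edgeWeight_comm r p]
  unfold edgeWeight
  generalize LastJoined A p q r = X₁ at *
  generalize LastJoined A q r p = X₂ at *
  generalize LastJoined A r p q = X₃ at *
  generalize LastJoined A q p r = X₄ at *
  generalize LastJoined A p r q = X₅ at *
  generalize LastJoined A r q p = X₆ at *
  generalize Dbl A p q = d₁ at *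
  generalize Dbl A q r = d₂ at *
  generalize Dbl A p r = d₃ at *
  generalize mult A p = a at *
  generalize mult A q = b at *
  generalize mult A r = c at *
  clear h hA
  have ha : a = 2 ∨ a = 3 ∨ (a ≠ 2 ∧ a ≠ 3 ∧ 4 ≤ a) := by omega
  have hb : b = 2 ∨ b = 3 ∨ b = 4 ∨ (b ≠ 2 ∧ b ≠ 3 ∧ b ≠ 4 ∧ 5 ≤ b) := by omega
  have hc : c = 2 ∨ c = 3 ∨ c = 4 ∨ (c ≠ 2 ∧ c ≠ 3 ∧ c ≠ 4 ∧ 5 ≤ c) := by omega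
  clear hp2
  rcases ha with rfl | rfl | ⟨ha₂, ha₃, ha⟩ <;> rcases hb with rfl | rfl | rfl | ⟨hb₂, hb₃, hb₄, hb⟩ <;>
    rcases hc with rfl | rfl | rfl | ⟨hc₂, hc₃, hc₄, hc⟩ <;> first | omega | skip
  all_goals
    by_cases h₁ : d₁ <;> by_cases h₂ : d₂ <;> by_cases h₃ : d₃ <;>
      simp only [ind, *, if_true, if_false, not_true, not_false_iff, true_and, and_true,
        false_and, and_false, or_false, false_or, Nat.reduceEqDiff, forall_true_left, imp_false,
        false_imp_iff] at n₁ n₂ n₃ n₄ n₅ n₆ ⊢ <;>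
      push_cast <;> (try split_ifs) <;> first | omega | tauto

theorem totalCharge_nonneg (hA : ∀ L ∈ A, IsLine L) {p q r : ℝ × ℝ} (h : Tri A p q r) :
    0 ≤ totalCharge A p q r := by
  rcases le_total (mult A p) (mult A q) with h₁ | h₁ <;>
    rcases le_total (mult A q) (mult A r) with h₂ | h₂ <;>
    rcases le_total (mult A p) (mult A r) with h₃ | h₃
  · exact totalCharge_nonneg_of_le hA h h₁ h₂
  · exact totalCharge_nonneg_of_le hA h h₁ h₂
  · rw [← totalCharge_swap, ← totalCharge_rotate]
    exact totalCharge_nonneg_of_le hA h.swap_right h₃ h₂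
  · rw [← totalCharge_rotate, ← totalCharge_rotate]
    exact totalCharge_nonneg_of_le hA h.rotate.rotate h₃ h₁
  · rw [← totalCharge_swap]
    exact totalCharge_nonneg_of_le hA h.swap h₁ h₃
  · rw [← totalCharge_rotate]
    exact totalCharge_nonneg_of_le hA h.rotate h₂ h₃
  · rw [← totalCharge_swap, ← totalCharge_rotate, ← totalCharge_rotate]
    exact totalCharge_nonneg_of_le hA h.swap_right.rotate h₂ h₁
  · rw [← totalCharge_swap, ← totalCharge_rotate, ← totalCharge_rotate]
    exact totalCharge_nonneg_of_le hA h.swap_right.rotate h₂ h₁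

/-- `F` is the set of ordered vertex triples of triangular cells. -/
def IsTriSet (A : Finset (Set (ℝ × ℝ))) (F : Finset ((ℝ × ℝ) × (ℝ × ℝ) × (ℝ × ℝ))) : Prop :=
  ∀ t, t ∈ F ↔ Tri A t.1 t.2.1 t.2.2

theorem finite_mult_ge_two (hA : ∀ L ∈ A, IsLine L) :
    {p : ℝ × ℝ | ∃ L ∈ A, ∃ M ∈ A, L ≠ M ∧ p ∈ L ∧ p ∈ M}.Finite := by
  have : {p : ℝ × ℝ | ∃ L ∈ A, ∃ M ∈ A, L ≠ M ∧ p ∈ L ∧ p ∈ M} ⊆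
      ⋃ c ∈ A ×ˢ A, {p | c.1 ≠ c.2 ∧ p ∈ c.1 ∧ p ∈ c.2} := by
    rintro p ⟨L, hL, M, hM, h⟩
    simp only [Set.mem_iUnion]
    exact ⟨(L, M), Finset.mem_product.2 ⟨hL, hM⟩, h⟩
  refine Set.Finite.subset (Set.Finite.biUnion (Finset.finite_toSet _) fun c hc => ?_) this
  obtain ⟨hL, hM⟩ := Finset.mem_product.1 (Finset.mem_coe.1 hc)
  apply Set.Subsingleton.finite
  rintro p ⟨hne, hp₁, hp₂⟩ q ⟨-, hq₁, hq₂⟩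
  by_contra hpq
  apply hne
  ext r
  rw [isLine_mem_iff (hA _ hL) hp₁ hq₁ hpq, isLine_mem_iff (hA _ hM) hp₂ hq₂ hpq]

theorem Tri.exists_lines (hA : ∀ L ∈ A, IsLine L) {p q r : ℝ × ℝ} (h : Tri A p q r) :
    ∃ L ∈ A, ∃ M ∈ A, L ≠ M ∧ p ∈ L ∧ p ∈ M := by
  obtain ⟨L, hL, hp, hq⟩ := h.joined₁
  obtain ⟨M, hM, hr, hp'⟩ := h.joined₃
  refine ⟨L, hL, M, hM, ?_, hp, hp'⟩
  rintro rfl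
  exact h.area_ne ((isLine_mem_iff (hA L hL) hp hq h.ne₁ r).1 hr)

theorem exists_isTriSet (hA : ∀ L ∈ A, IsLine L) : ∃ F, IsTriSet A F := by
  have hV := finite_mult_ge_two hA
  have hf : {t : (ℝ × ℝ) × (ℝ × ℝ) × (ℝ × ℝ) | Tri A t.1 t.2.1 t.2.2}.Finite := by
    refine (hV.prod (hV.prod hV)).subset ?_
    intro t ht
    exact ⟨ht.exists_lines hA, ht.rotate.exists_lines hA, ht.rotate.rotate.exists_lines hA⟩
  exact ⟨hf.toFinset, fun t => by simp⟩

namespace IsTriSet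

variable {F : Finset ((ℝ × ℝ) × (ℝ × ℝ) × (ℝ × ℝ))}

theorem sum_rotate (hF : IsTriSet A F) (f : ℝ × ℝ → ℝ × ℝ → ℝ × ℝ → ℤ) :
    ∑ t ∈ F, f t.2.1 t.2.2 t.1 = ∑ t ∈ F, f t.1 t.2.1 t.2.2 :=
  Finset.sum_nbij' (fun t => (t.2.1, t.2.2, t.1)) (fun t => (t.2.2, t.1, t.2.1))
    (fun t ht => (hF _).2 ((hF t).1 ht).rotate)
    (fun t ht => (hF _).2 ((hF t).1 ht).rotate.rotate)
    (fun _ _ => rfl) (fun _ _ => rfl) (fun _ _ => rfl)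

theorem sum_swap (hF : IsTriSet A F) (f : ℝ × ℝ → ℝ × ℝ → ℝ × ℝ → ℤ) :
    ∑ t ∈ F, f t.2.1 t.1 t.2.2 = ∑ t ∈ F, f t.1 t.2.1 t.2.2 :=
  Finset.sum_nbij' (fun t => (t.2.1, t.1, t.2.2)) (fun t => (t.2.1, t.1, t.2.2))
    (fun t ht => (hF _).2 ((hF t).1 ht).swap)
    (fun t ht => (hF _).2 ((hF t).1 ht).swap)
    (fun _ _ => rfl) (fun _ _ => rfl) (fun _ _ => rfl)

theorem sum_charge_nonneg (hA : ∀ L ∈ A, IsLine L) (hF : IsTriSet A F) :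
    0 ≤ ∑ t ∈ F, charge A t.1 t.2.1 t.2.2 := by
  have h : 0 ≤ ∑ t ∈ F, totalCharge A t.1 t.2.1 t.2.2 :=
    Finset.sum_nonneg fun t ht => totalCharge_nonneg hA ((hF t).1 ht)
  unfold totalCharge at h
  simp only [Finset.sum_add_distrib] at h
  have h₁ := hF.sum_rotate (charge A)
  have h₂ := hF.sum_rotate (fun x y z => charge A y z x)
  have h₃ := hF.sum_swap (charge A)
  have h₄ := hF.sum_swap (fun x y z => charge A y z x)
  have h₅ := hF.sum_swap (fun x y z => charge A z x y)
  linarith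

theorem card_le_of_relations {α : Type*} {N D₁ D₂ D₃ : Finset α} (R₁ R₂ R₃ : α → α → Prop)
    (h : ∀ s ∈ N, (∃ t ∈ D₁, R₁ s t) ∨ (∃ t ∈ D₂, R₂ s t) ∨ ∃ t ∈ D₃, R₃ s t)
    (h₁ : ∀ t ∈ D₁, ∀ s ∈ N, ∀ s' ∈ N, R₁ s t → R₁ s' t → s = s')
    (h₂ : ∀ t ∈ D₂, ∀ s ∈ N, ∀ s' ∈ N, R₂ s t → R₂ s' t → s = s')
    (h₃ : ∀ t ∈ D₃, ∀ s ∈ N, ∀ s' ∈ N, R₃ s t → R₃ s' t → s = s') :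
    N.card ≤ D₁.card + D₂.card + D₃.card := by
  classical
  have key : ∀ (D : Finset α) (R : α → α → Prop),
      (∀ t ∈ D, ∀ s ∈ N, ∀ s' ∈ N, R s t → R s' t → s = s') →
      (N.filter fun s => ∃ t ∈ D, R s t).card ≤ D.card := by
    intro D R hu
    refine Finset.card_le_card_of_forall_subsingleton R
      (fun s hs => by simpa using (Finset.mem_filter.1 hs).2) ?_
    rintro t ht s ⟨hs, hr⟩ s' ⟨hs', hr'⟩
    exact hu t ht s (Finset.mem_of_mem_filter _ hs) s' (Finset.mem_of_mem_filter _ hs') hr hr'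
  have hsub : N ⊆ (N.filter fun s => ∃ t ∈ D₁, R₁ s t) ∪ (N.filter fun s => ∃ t ∈ D₂, R₂ s t) ∪
      N.filter fun s => ∃ t ∈ D₃, R₃ s t := by
    intro s hs
    simpa [hs, or_assoc] using h s hs
  exact (Finset.card_le_card hsub).trans ((Finset.card_union_le _ _).trans
    (add_le_add ((Finset.card_union_le _ _).trans (add_le_add (key _ _ h₁) (key _ _ h₂)))
      (key _ _ h₃)))

open Classical in
theorem card_neg_le (hA : ∀ L ∈ A, IsLine L) (hF : IsTriSet A F) :
    (F.filter fun t => Neg A t.1 t.2.1 t.2.2).card ≤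
      (F.filter fun t => DonorOne A t.1 t.2.1 t.2.2).card +
      (F.filter fun t => DonorTwo A t.1 t.2.1 t.2.2).card +
      (F.filter fun t => DonorThree A t.1 t.2.1 t.2.2).card := by
  refine card_le_of_relations
    (fun s t => t.1 = s.1 ∧ t.2.1 = s.2.1 ∧ t.2.2 ≠ s.2.2)
    (fun s t => t.1 = s.1 ∧ Flanked A s.1 s.2.1 s.2.2 t.2.1 t.2.2)
    (fun s t => t.2.2 ≠ s.1 ∧ Tri A s.1 t.1 t.2.1 ∧ Flanked A s.1 s.2.1 s.2.2 t.1 t.2.1)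
    ?_ ?_ ?_ ?_
  · intro s hs
    simp only [Finset.mem_filter]
    rcases (Finset.mem_filter.1 hs).2.exists_donor hA with
      ⟨v, hv, hd⟩ | ⟨u, v, hd, hf⟩ | ⟨u, v, q, hd, hq, ht, hf⟩
    · exact Or.inl ⟨(s.1, s.2.1, v), ⟨(hF _).2 hd.tri, hd⟩, rfl, rfl, hv⟩
    · exact Or.inr (Or.inl ⟨(s.1, u, v), ⟨(hF _).2 hd.tri, hd⟩, rfl, hf⟩)
    · exact Or.inr (Or.inr ⟨(u, v, q), ⟨(hF _).2 hd.tri, hd⟩, hq, ht, hf⟩)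
  · rintro ⟨a, x, v⟩ ht ⟨b, y, z⟩ hs ⟨b', y', z'⟩ hs' ⟨h₁, h₂, h₃⟩ ⟨h₁', h₂', h₃'⟩
    simp only at h₁ h₂ h₃ h₁' h₂' h₃'
    subst h₁ h₂ h₁' h₂'
    obtain rfl : z = z' := (Finset.mem_filter.1 ht).2.unique (Finset.mem_filter.1 hs).2
      (Finset.mem_filter.1 hs').2 h₃ h₃'
    rfl
  · rintro ⟨a, u, v⟩ ht ⟨b, y, z⟩ hs ⟨b', y', z'⟩ hs' ⟨h₁, h₂⟩ ⟨h₁', h₂'⟩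
    simp only at h₁ h₂ h₁' h₂'
    subst h₁ h₁'
    obtain ⟨rfl, rfl⟩ := h₂.unique (Finset.mem_filter.1 ht).2.tri h₂'
    rfl
  · rintro ⟨u, v, q⟩ ht ⟨b, y, z⟩ hs ⟨b', y', z'⟩ hs' ⟨h₁, h₂, h₃⟩ ⟨h₁', h₂', h₃'⟩
    simp only at h₁ h₂ h₃ h₁' h₂' h₃'
    obtain rfl := (Finset.mem_filter.1 ht).2.tri.other_unique h₂.rotate h₂'.rotate h₁.symm h₁'.symm
    obtain ⟨rfl, rfl⟩ := h₃.unique h₂ h₃'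
    rfl

theorem sum_ind (f : ℝ × ℝ → ℝ × ℝ → ℝ × ℝ → Prop) [DecidablePred fun
    t : (ℝ × ℝ) × (ℝ × ℝ) × (ℝ × ℝ) => f t.1 t.2.1 t.2.2] :
    ∑ t ∈ F, ind (f t.1 t.2.1 t.2.2) = ((F.filter fun t => f t.1 t.2.1 t.2.2).card : ℤ) := by
  rw [Finset.card_filter]
  push_cast
  refine Finset.sum_congr rfl fun t _ => ?_
  unfold ind
  congr

theorem sum_edgeWeight_nonneg (hA : ∀ L ∈ A, IsLine L) (hF : IsTriSet A F) :
    0 ≤ ∑ t ∈ F, edgeWeight A t.1 t.2.1 := by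
  classical
  have h := hF.sum_charge_nonneg hA
  have h' := hF.card_neg_le hA
  unfold charge at h
  simp only [Finset.sum_sub_distrib, Finset.sum_add_distrib, ← Finset.mul_sum, sum_ind] at h
  omega

end IsTriSet

theorem IsLine.exists_coordinate {L : Set (ℝ × ℝ)} (hL : IsLine L) : ∃ φ : ℝ × ℝ → ℝ,
    (∀ x ∈ L, ∀ y ∈ L, φ x = φ y → x = y) ∧
    ∀ x ∈ L, ∀ y ∈ L, ∀ z ∈ L, φ x < φ y → φ y < φ z → Beyond x y z := by
  obtain ⟨a, b, c, hab, rfl⟩ := hL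
  have hN : 0 < a ^ 2 + b ^ 2 := by
    by_contra h
    apply hab
    have ha : a ^ 2 = 0 := by nlinarith [sq_nonneg a, sq_nonneg b]
    have hb : b ^ 2 = 0 := by nlinarith [sq_nonneg a, sq_nonneg b]
    rw [pow_eq_zero_iff two_ne_zero] at ha hb
    rw [ha, hb]
  have key : ∀ p : ℝ × ℝ, a * p.1 + b * p.2 = c →
      p = ((a * c + b * (b * p.1 - a * p.2)) / (a ^ 2 + b ^ 2),
        (b * c - a * (b * p.1 - a * p.2)) / (a ^ 2 + b ^ 2)) := by
    rintro p rfl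
    ext <;> field_simp <;> ring
  refine ⟨fun p => b * p.1 - a * p.2, ?_, ?_⟩
  · intro x hx y hy h
    simp only at h
    rw [key x hx, key y hy, h]
  · intro x hx y hy z hz hxy hyz
    have e₁ := key x hx
    have e₂ := key y hy
    have e₃ := key z hz
    simp only at hxy hyz
    generalize b * x.1 - a * x.2 = s at *
    generalize b * y.1 - a * y.2 = t at *
    generalize b * z.1 - a * z.2 = u at *
    subst e₁ e₂ e₃
    have hts : t - s ≠ 0 := by linarith
    refine ⟨(u - t) / (t - s), div_pos (by linarith) (by linarith), ?_⟩
    ext <;> simp only [linePoint] <;> field_simp <;> ring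

namespace IsTriSet

variable {F : Finset ((ℝ × ℝ) × (ℝ × ℝ) × (ℝ × ℝ))}

open Classical in
/-- The oriented edges of the triangular cells. -/
noncomputable def edges (F : Finset ((ℝ × ℝ) × (ℝ × ℝ) × (ℝ × ℝ))) :
    Finset ((ℝ × ℝ) × (ℝ × ℝ)) :=
  F.image fun t => (t.1, t.2.1)

theorem mem_edges (hF : IsTriSet A F) {e : (ℝ × ℝ) × (ℝ × ℝ)} :
    e ∈ edges F ↔ ∃ z, Tri A e.1 e.2 z := by
  unfold edges
  rw [Finset.mem_image]
  constructor
  · rintro ⟨t, ht, rfl⟩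
    exact ⟨t.2.2, (hF t).1 ht⟩
  · rintro ⟨z, hz⟩
    exact ⟨(e.1, e.2, z), (hF _).2 hz, rfl⟩

theorem sum_edgeWeight_eq (hF : IsTriSet A F) : ∑ t ∈ F, edgeWeight A t.1 t.2.1 =
    ∑ e ∈ edges F, 2 * ((mult A e.1 : ℤ) + mult A e.2 - 2) - 4 * F.card := by
  classical
  have hm : ∀ t ∈ F, (t.1, t.2.1) ∈ edges F := fun t ht =>
    hF.mem_edges.2 ⟨t.2.2, (hF t).1 ht⟩
  rw [← Finset.sum_fiberwise_of_maps_to hm, Finset.card_eq_sum_card_fiberwise hm]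
  push_cast
  rw [Finset.mul_sum, ← Finset.sum_sub_distrib]
  refine Finset.sum_congr rfl fun e he => ?_
  obtain ⟨z, hz⟩ := hF.mem_edges.1 he
  have hc : ∑ t ∈ F with (t.1, t.2.1) = e, edgeWeight A t.1 t.2.1 =
      (F.filter fun t => (t.1, t.2.1) = e).card * edgeWeight A e.1 e.2 := by
    rw [← nsmul_eq_mul]
    refine Finset.sum_eq_card_nsmul fun t ht => ?_
    rw [← (Finset.mem_filter.1 ht).2]
  rw [hc]
  by_cases hd : Dbl A e.1 e.2
  · obtain ⟨w, hwz, hw⟩ := hd.exists_ne z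
    have : F.filter (fun t => (t.1, t.2.1) = e) = {(e.1, e.2, z), (e.1, e.2, w)} := by
      ext t
      rw [Finset.mem_filter, Finset.mem_insert, Finset.mem_singleton, hF t]
      constructor
      · rintro ⟨ht, rfl⟩
        rcases hz.eq_or_eq hw ht hwz.symm with h | h
        · left; rw [← h]
        · right; rw [← h]
      · rintro (rfl | rfl)
        · exact ⟨hz, rfl⟩
        · exact ⟨hw, rfl⟩
    rw [this, Finset.card_pair (by simpa using hwz.symm)]
    unfold edgeWeight
    rw [if_pos hd]
    push_cast
    ring
  · have : F.filter (fun t => (t.1, t.2.1) = e) = {(e.1, e.2, z)} := by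
      ext t
      rw [Finset.mem_filter, Finset.mem_singleton, hF t]
      constructor
      · rintro ⟨ht, rfl⟩
        by_contra hne
        refine hd ⟨z, t.2.2, ?_, hz, ht⟩
        rintro rfl
        exact hne rfl
      · rintro rfl
        exact ⟨hz, rfl⟩
    rw [this, Finset.card_singleton]
    unfold edgeWeight
    rw [if_neg hd]
    push_cast
    ring

theorem sum_mult_swap (hF : IsTriSet A F) :
    ∑ e ∈ edges F, (mult A e.2 : ℤ) = ∑ e ∈ edges F, (mult A e.1 : ℤ) := by
  refine Finset.sum_nbij' Prod.swap Prod.swap ?_ ?_ ?_ ?_ ?_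
  · intro e he
    obtain ⟨z, hz⟩ := hF.mem_edges.1 he
    exact hF.mem_edges.2 ⟨z, hz.swap⟩
  · intro e he
    obtain ⟨z, hz⟩ := hF.mem_edges.1 he
    exact hF.mem_edges.2 ⟨z, hz.swap⟩
  · exact fun _ _ => rfl
  · exact fun _ _ => rfl
  · exact fun _ _ => rfl

open Classical in
/-- Oriented edges together with a line crossing them at the start point. -/
noncomputable def crossings (A : Finset (Set (ℝ × ℝ)))
    (F : Finset ((ℝ × ℝ) × (ℝ × ℝ) × (ℝ × ℝ))) :
    Finset (((ℝ × ℝ) × (ℝ × ℝ)) × Set (ℝ × ℝ)) :=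
  (edges F ×ˢ A).filter fun c => c.1.1 ∈ c.2 ∧ c.1.2 ∉ c.2

theorem card_crossings (hA : ∀ L ∈ A, IsLine L) (hF : IsTriSet A F) :
    ((crossings A F).card : ℤ) = ∑ e ∈ edges F, ((mult A e.1 : ℤ) - 1) := by
  classical
  have hm : ∀ c ∈ crossings A F, c.1 ∈ edges F := fun c hc =>
    (Finset.mem_product.1 (Finset.mem_filter.1 hc).1).1
  rw [Finset.card_eq_sum_card_fiberwise hm]
  push_cast
  refine Finset.sum_congr rfl fun e he => ?_
  obtain ⟨z, hz⟩ := hF.mem_edges.1 he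
  obtain ⟨L, hL, h₁, h₂⟩ := hz.joined₁
  have hLm : L ∈ A.filter fun M => e.1 ∈ M := Finset.mem_filter.2 ⟨hL, h₁⟩
  have : (crossings A F).filter (fun c => c.1 = e) =
      ((A.filter fun M => e.1 ∈ M).erase L).image fun M => (e, M) := by
    ext c
    simp only [crossings, Finset.mem_filter, Finset.mem_product, Finset.mem_image,
      Finset.mem_erase]
    constructor
    · rintro ⟨⟨⟨-, hM⟩, hc₁, hc₂⟩, rfl⟩
      refine ⟨c.2, ⟨?_, hM, hc₁⟩, rfl⟩
      rintro rfl
      exact hc₂ h₂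
    · rintro ⟨M, ⟨hne, hM, hM₁⟩, rfl⟩
      refine ⟨⟨⟨he, hM⟩, hM₁, fun hM₂ => hne ?_⟩, rfl⟩
      ext r
      rw [isLine_mem_iff (hA M hM) hM₁ hM₂ hz.ne₁, isLine_mem_iff (hA L hL) h₁ h₂ hz.ne₁]
  rw [this, Finset.card_image_of_injective _ (Prod.mk_right_injective e),
    Finset.card_erase_of_mem hLm]
  have hpos := Finset.card_pos.2 ⟨L, hLm⟩
  have hmult : mult A e.1 = (A.filter fun M => e.1 ∈ M).card := by
    unfold mult; congr
  rw [hmult]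
  omega

open Classical in
theorem card_crossings_on_line_le (hA : ∀ L ∈ A, IsLine L) (hF : IsTriSet A F)
    {L : Set (ℝ × ℝ)} (hL : L ∈ A) (φ : ℝ × ℝ → ℝ)
    (hφ : ∀ x ∈ L, ∀ y ∈ L, φ x = φ y → x = y)
    (hb : ∀ x ∈ L, ∀ y ∈ L, ∀ z ∈ L, φ x < φ y → φ y < φ z → Beyond x y z) :
    ((crossings A F).filter fun c => c.1.1 ∈ L ∧ c.1.2 ∈ L ∧ φ c.1.1 < φ c.1.2).card ≤
      A.card - 2 := by
  set T := (crossings A F).filter fun c => c.1.1 ∈ L ∧ c.1.2 ∈ L ∧ φ c.1.1 < φ c.1.2 with hT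
  have hmem : ∀ c ∈ T, (∃ z, Tri A c.1.1 c.1.2 z) ∧ c.2 ∈ A ∧ c.1.1 ∈ c.2 ∧ c.1.2 ∉ c.2 ∧
      c.1.1 ∈ L ∧ c.1.2 ∈ L ∧ φ c.1.1 < φ c.1.2 := by
    intro c hc
    simp only [hT, crossings, Finset.mem_filter, Finset.mem_product] at hc
    exact ⟨hF.mem_edges.1 hc.1.1.1, hc.1.1.2, hc.1.2.1, hc.1.2.2, hc.2⟩
  rcases T.eq_empty_or_nonempty with h0 | hne
  · rw [h0]; simp
  obtain ⟨c₀, hc₀, hmax⟩ := T.exists_max_image (fun c => φ c.1.2) hne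
  obtain ⟨⟨z₀, hz₀⟩, -, -, -, h₀, h₀', hlt₀⟩ := hmem c₀ hc₀
  obtain ⟨M₀, hM₀, hM₀L, hcM₀⟩ : ∃ M ∈ A, M ≠ L ∧ c₀.1.2 ∈ M := by
    obtain ⟨M, hM, N, hN, hMN, h₁, h₂⟩ := hz₀.swap.exists_lines hA
    by_cases h : M = L
    · exact ⟨N, hN, fun h' => hMN (h.trans h'.symm), h₂⟩
    · exact ⟨M, hM, h, h₁⟩
  have hpt : ∀ M ∈ A, M ≠ L → ∀ x y, x ∈ M → x ∈ L → y ∈ M → y ∈ L → x = y := by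
    intro M hM hne x y hx hx' hy hy'
    by_contra hxy
    apply hne
    ext r
    rw [isLine_mem_iff (hA M hM) hx hy hxy, isLine_mem_iff (hA L hL) hx' hy' hxy]
  have hcard : ((A.erase L).erase M₀).card = A.card - 2 := by
    rw [Finset.card_erase_of_mem (Finset.mem_erase.2 ⟨hM₀L, hM₀⟩), Finset.card_erase_of_mem hL]
    omega
  rw [← hcard]
  refine Finset.card_le_card_of_injOn Prod.snd ?_ ?_
  · intro c hc
    obtain ⟨-, h₂, h₃, h₄, h₅, h₆, h₇⟩ := hmem c hc
    rw [Finset.mem_coe, Finset.mem_erase, Finset.mem_erase]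
    have hcL : c.2 ≠ L := by intro h; rw [h] at h₄; exact h₄ h₆
    refine ⟨?_, hcL, h₂⟩
    intro h
    rw [h] at h₃
    have e := hpt M₀ hM₀ hM₀L _ _ h₃ h₅ hcM₀ h₀'
    have := hmax c hc
    rw [e] at h₇
    linarith
  · rintro ⟨⟨x, y⟩, M⟩ hc ⟨⟨x', y'⟩, M'⟩ hc' hMM
    obtain ⟨⟨z, hz⟩, h₂, h₃, h₄, h₅, h₆, h₇⟩ := hmem _ hc
    obtain ⟨⟨z', hz'⟩, h₂', h₃', h₄', h₅', h₆', h₇'⟩ := hmem _ hc'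
    simp only at *
    subst hMM
    have hML : M ≠ L := by rintro rfl; exact h₄ h₆
    obtain rfl := hpt M h₂ hML x x' h₃ h₅ h₃' h₅'
    rcases lt_trichotomy (φ y) (φ y') with h | h | h
    · exact absurd (hb x h₅ y h₆ y' h₆' h₇ h) (hz.not_beyond hz')
    · rw [hφ y h₆ y' h₆' h]
    · exact absurd (hb x h₅ y' h₆' y h₆ h₇' h) (hz'.not_beyond hz)

theorem card_crossings_le (hA : ∀ L ∈ A, IsLine L) (hF : IsTriSet A F) :
    (crossings A F).card ≤ A.card * (2 * (A.card - 2)) := by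
  classical
  have hex : ∀ L ∈ A, ∃ φ : ℝ × ℝ → ℝ, (∀ x ∈ L, ∀ y ∈ L, φ x = φ y → x = y) ∧
    ∀ x ∈ L, ∀ y ∈ L, ∀ z ∈ L, φ x < φ y → φ y < φ z → Beyond x y z := fun L hL =>
    IsLine.exists_coordinate (hA L hL)
  choose! φ hφ hb using hex
  refine le_trans (Finset.card_le_card (t := A.biUnion fun L =>
    ((crossings A F).filter fun c => c.1.1 ∈ L ∧ c.1.2 ∈ L ∧ φ L c.1.1 < φ L c.1.2) ∪
    ((crossings A F).filter fun c => c.1.1 ∈ L ∧ c.1.2 ∈ L ∧ -φ L c.1.1 < -φ L c.1.2)) ?_)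
    (Finset.card_biUnion_le_card_mul _ _ _ fun L hL => ?_)
  · intro c hc
    have he := (Finset.mem_product.1 (Finset.mem_filter.1 hc).1).1
    obtain ⟨z, hz⟩ := hF.mem_edges.1 he
    obtain ⟨L, hL, h₁, h₂⟩ := hz.joined₁
    rw [Finset.mem_biUnion]
    refine ⟨L, hL, ?_⟩
    rw [Finset.mem_union, Finset.mem_filter, Finset.mem_filter]
    rcases lt_trichotomy (φ L c.1.1) (φ L c.1.2) with h | h | h
    · exact Or.inl ⟨hc, h₁, h₂, h⟩
    · exact absurd (hφ L hL _ h₁ _ h₂ h) hz.ne₁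
    · exact Or.inr ⟨hc, h₁, h₂, by linarith⟩
  · refine (Finset.card_union_le _ _).trans ?_
    rw [two_mul]
    refine add_le_add ?_ ?_
    · convert hF.card_crossings_on_line_le hA hL (φ L) (hφ L hL) (hb L hL)
    · convert hF.card_crossings_on_line_le hA hL (fun p => -φ L p)
        (fun x hx y hy h => hφ L hL x hx y hy (neg_injective h))
        (fun x hx y hy z hz h h' => (hb L hL z hz y hy x hx (by linarith) (by linarith)).symm)

theorem card_le (hA : ∀ L ∈ A, IsLine L) (hF : IsTriSet A F) :
    F.card ≤ 2 * (A.card * (A.card - 2)) := by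
  have h₁ := hF.sum_edgeWeight_nonneg hA
  have h₂ := hF.card_crossings hA
  have h₃ := hF.card_crossings_le hA
  have h₄ := hF.sum_mult_swap
  rw [hF.sum_edgeWeight_eq, ← Finset.mul_sum] at h₁
  simp only [Finset.sum_sub_distrib, Finset.sum_add_distrib, Finset.sum_const, nsmul_eq_mul,
    mul_one] at h₁ h₂
  rw [mul_left_comm] at h₃
  omega

end IsTriSet

theorem IsLine.isClosed {L : Set (ℝ × ℝ)} (hL : IsLine L) : IsClosed L := by
  obtain ⟨a, b, c, -, rfl⟩ := hL
  exact isClosed_eq (by fun_prop) continuous_const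

theorem isOpen_compl_iUnion (hA : ∀ L ∈ A, IsLine L) : IsOpen (⋃ L ∈ A, L)ᶜ :=
  (A.finite_toSet.isClosed_biUnion fun L hL => IsLine.isClosed (hA L hL)).isOpen_compl

theorem continuous_area (s t : ℝ × ℝ) : Continuous fun x => area s t x := by
  unfold area; fun_prop

theorem convex_setOf_area_nonneg (s t : ℝ × ℝ) (k : ℝ) : Convex ℝ {x | 0 ≤ k * area s t x} := by
  intro x hx y hy a b ha hb hab
  simp only [Set.mem_ofPred_eq] at *
  have : area s t (a • x + b • y) = a * area s t x + b * area s t y := by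
    unfold area
    simp only [Prod.fst_add, Prod.snd_add, Prod.smul_fst, Prod.smul_snd, smul_eq_mul]
    linear_combination ((t.1 - s.1) * s.2 - (t.2 - s.2) * s.1) * hab
  rw [this]
  nlinarith [mul_nonneg ha hx, mul_nonneg hb hy]

theorem linePoint_mem_convexHull {p q : ℝ × ℝ} {S : Set (ℝ × ℝ)} (hp : p ∈ S) (hq : q ∈ S)
    {t : ℝ} (h₀ : 0 ≤ t) (h₁ : t ≤ 1) : linePoint p q t ∈ convexHull ℝ S := by
  have : linePoint p q t = (1 - t) • p + t • q := by
    ext <;> simp [linePoint] <;> ring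
  rw [this]
  exact convex_convexHull ℝ S (subset_convexHull ℝ S hp) (subset_convexHull ℝ S hq)
    (by linarith) h₀ (by ring)

theorem area_ne_zero_of_not_collinear {p q r : ℝ × ℝ}
    (h : ¬ Collinear ℝ ({p, q, r} : Set (ℝ × ℝ))) : area p q r ≠ 0 := by
  intro h0
  apply h
  by_cases hqp : q = p
  · subst hqp
    simpa using collinear_pair ℝ q r
  · obtain ⟨t, rfl⟩ := exists_linePoint hqp h0
    rw [collinear_iff_of_mem (p₀ := p) (by simp)]
    refine ⟨q - p, ?_⟩
    rintro x (rfl | rfl | rfl)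
    · exact ⟨0, by simp⟩
    · exact ⟨1, by simp⟩
    · exact ⟨t, by ext <;> simp [linePoint] <;> ring⟩

theorem joined_of_segment (hA : ∀ L ∈ A, IsLine L) {p q : ℝ × ℝ} (hpq : p ≠ q)
    (h : ∀ t : ℝ, 0 ≤ t → t ≤ 1 → linePoint p q t ∈ ⋃ L ∈ A, L) : Joined A p q := by
  have h' : ∀ n : ℕ, ∃ L : A, linePoint p q (1 / (n + 1)) ∈ (L : Set (ℝ × ℝ)) := by
    intro n
    have h1 : (1 : ℝ) / (n + 1) ≤ 1 := by
      rw [div_le_one (by positivity)]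
      linarith [n.cast_nonneg (α := ℝ)]
    obtain ⟨L, hL, hx⟩ := Set.mem_iUnion₂.1 (h (1 / (n + 1)) (by positivity) h1)
    exact ⟨⟨L, hL⟩, hx⟩
  choose f hf using h'
  obtain ⟨m, n, hmn, he⟩ := Finite.exists_ne_map_eq_of_infinite f
  have hm := hf m
  have hn := hf n
  rw [he] at hm
  have hne : (1 : ℝ) / (m + 1) ≠ 1 / (n + 1) := by
    intro h
    rw [div_eq_div_iff (by positivity) (by positivity)] at h
    apply hmn
    exact_mod_cast (by linarith : (m : ℝ) = n)
  have hne' : linePoint p q (1 / (m + 1)) ≠ linePoint p q (1 / (n + 1)) := by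
    intro h
    have h₁ := congrArg Prod.fst h
    have h₂ := congrArg Prod.snd h
    simp only [linePoint] at h₁ h₂
    apply hpq
    have hs := sub_ne_zero.2 hne
    ext
    · apply mul_left_cancel₀ hs; linarith
    · apply mul_left_cancel₀ hs; linarith
  refine ⟨f n, (f n).2, ?_, ?_⟩
  · rw [isLine_mem_iff (hA _ (f n).2) hm hn hne']
    unfold area linePoint; ring
  · rw [isLine_mem_iff (hA _ (f n).2) hm hn hne']
    unfold area linePoint; ring

theorem mem_component_of_mem_closure {X : Type*} [TopologicalSpace X] [LocallyConnectedSpace X]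
    {U : Set X} (hU : IsOpen U) {o x : X} (hx : x ∈ closure (connectedComponentIn U o))
    (hxU : x ∈ U) : x ∈ connectedComponentIn U o := by
  obtain ⟨y, hy₁, hy₂⟩ := mem_closure_iff.1 hx _ hU.connectedComponentIn
    (mem_connectedComponentIn hxU)
  rw [connectedComponentIn_eq hy₂, ← connectedComponentIn_eq hy₁]
  exact mem_connectedComponentIn hxU

theorem component_sign (hA : ∀ L ∈ A, IsLine L) {o s t : ℝ × ℝ} (hst : s ≠ t)
    (h : Joined A s t) {x y : ℝ × ℝ}
    (hx : x ∈ closure (connectedComponentIn (⋃ L ∈ A, L)ᶜ o))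
    (hy : y ∈ closure (connectedComponentIn (⋃ L ∈ A, L)ᶜ o)) :
    0 ≤ area s t x * area s t y := by
  set F := connectedComponentIn (⋃ L ∈ A, L)ᶜ o with hF
  obtain ⟨L, hL, hs, ht⟩ := h
  have hne : ∀ z ∈ F, area s t z ≠ 0 := by
    intro z hz h0
    exact connectedComponentIn_subset _ _ hz
      (Set.mem_biUnion hL ((isLine_mem_iff (hA L hL) hs ht hst z).2 h0))
  have hpos : ∀ y ∈ F, ∀ z ∈ F, 0 ≤ area s t y * area s t z := by
    have key : ∀ y ∈ F, ∀ z ∈ F, area s t y < 0 → 0 < area s t z → False := by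
      intro y hy z hz h₁ h₂
      obtain ⟨w, hw, hw0⟩ := (isPreconnected_connectedComponentIn (F := (⋃ L ∈ A, L)ᶜ)
        (x := o)).intermediate_value hy hz (continuous_area s t).continuousOn ⟨h₁.le, h₂.le⟩
      exact hne w hw hw0
    intro y hy z hz
    rcases lt_or_gt_of_ne (hne y hy) with h₁ | h₁ <;> rcases lt_or_gt_of_ne (hne z hz) with h₂ | h₂
    · exact (mul_pos_of_neg_of_neg h₁ h₂).le
    · exact (key y hy z hz h₁ h₂).elim
    · exact (key z hz y hy h₂ h₁).elim
    · exact (mul_pos h₁ h₂).le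
  have h₁ : ∀ y ∈ F, ∀ x ∈ closure F, 0 ≤ area s t y * area s t x := fun y hy =>
    closure_minimal (hpos y hy)
      (isClosed_le continuous_const (continuous_const.mul (continuous_area s t)))
  have h₂ : ∀ x ∈ closure F, ∀ y ∈ closure F, 0 ≤ area s t y * area s t x := fun x hx =>
    closure_minimal (fun y hy => h₁ y hy x hx)
      (isClosed_le continuous_const ((continuous_area s t).mul continuous_const))
  exact h₂ y hy x hx

theorem joined_of_closure_eq (hA : ∀ L ∈ A, IsLine L) {o p q r : ℝ × ℝ}
    (hc : closure (connectedComponentIn (⋃ L ∈ A, L)ᶜ o) =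
      convexHull ℝ ({p, q, r} : Set (ℝ × ℝ))) (hne : area p q r ≠ 0) : Joined A p q := by
  have hU := isOpen_compl_iUnion hA
  refine joined_of_segment hA (fun h => hne (by rw [h, area_self_left])) fun t h₀ h₁ => ?_
  by_contra hx
  have hxF := mem_component_of_mem_closure (o := o) hU
    (by rw [hc]; exact linePoint_mem_convexHull (by simp) (by simp) h₀ h₁) hx
  have hsub : connectedComponentIn (⋃ L ∈ A, L)ᶜ o ⊆ {x | 0 ≤ area p q r * area p q x} := by
    refine subset_closure.trans ?_
    rw [hc]
    refine convexHull_min ?_ (convex_setOf_area_nonneg p q _)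
    rintro x (rfl | rfl | rfl)
    · simp
    · simp
    · exact mul_self_nonneg (area p q x)
  have hcont : Continuous fun u : ℝ => linePoint (linePoint p q t) r u := by
    unfold linePoint; fun_prop
  have hnear : ∀ᶠ u in nhdsWithin (0 : ℝ) (Set.Iio 0),
      linePoint (linePoint p q t) r u ∈ connectedComponentIn (⋃ L ∈ A, L)ᶜ o := by
    refine (hcont.tendsto 0).mono_left nhdsWithin_le_nhds
      (hU.connectedComponentIn.mem_nhds ?_)
    simpa [linePoint] using hxF
  obtain ⟨u, hu, hu0⟩ := (hnear.and self_mem_nhdsWithin).exists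
  have h1 := hsub hu
  have h2 : area p q (linePoint (linePoint p q t) r u) = u * area p q r := by
    unfold area linePoint; ring
  rw [Set.mem_ofPred_eq, h2] at h1
  have hu0' : u < 0 := hu0
  nlinarith [mul_pos (mul_self_pos.2 hne) (neg_pos.2 hu0')]

end LineArrangement

namespace IsTriangularFace

open LineArrangement

variable {A : Finset (Set (ℝ × ℝ))} {F G : Set (ℝ × ℝ)}

theorem exists_tri (hA : ∀ L ∈ A, IsLine L) (hF : IsTriangularFace A F) :
    ∃ p q r, Tri A p q r ∧ closure F = convexHull ℝ ({p, q, r} : Set (ℝ × ℝ)) := by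
  obtain ⟨⟨o, -, rfl⟩, -, p, q, r, hcol, hc⟩ := hF
  have hne := area_ne_zero_of_not_collinear hcol
  have hmem : ∀ x ∈ ({p, q, r} : Set (ℝ × ℝ)),
      x ∈ closure (connectedComponentIn (⋃ L ∈ A, L)ᶜ o) := by
    rw [hc]
    exact subset_convexHull ℝ _
  have hp := hmem p (by simp)
  have hq := hmem q (by simp)
  have hr := hmem r (by simp)
  have e₁ : ({q, r, p} : Set (ℝ × ℝ)) = {p, q, r} := by
    ext x; simp only [Set.mem_insert_iff, Set.mem_singleton_iff]; tauto
  have e₂ : ({r, p, q} : Set (ℝ × ℝ)) = {p, q, r} := by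
    ext x; simp only [Set.mem_insert_iff, Set.mem_singleton_iff]; tauto
  exact ⟨p, q, r, ⟨hne, joined_of_closure_eq hA hc hne,
    joined_of_closure_eq hA (r := p) (by rw [hc, e₁]) (by rwa [area_rotate]),
    joined_of_closure_eq hA (r := q) (by rw [hc, e₂]) (by rwa [area_rotate, area_rotate]),
    fun s t hst h => component_sign hA hst h hp hq,
    fun s t hst h => component_sign hA hst h hq hr,
    fun s t hst h => component_sign hA hst h hr hp⟩, hc⟩

theorem eq_of_closure_eq (hA : ∀ L ∈ A, IsLine L) (hF : IsTriangularFace A F)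
    (hG : IsTriangularFace A G) (h : closure F = closure G) : F = G := by
  obtain ⟨⟨o, ho, rfl⟩, -⟩ := hF
  obtain ⟨⟨o', -, rfl⟩, -⟩ := hG
  have hU := isOpen_compl_iUnion hA
  have ho' := mem_connectedComponentIn ho
  have := mem_component_of_mem_closure hU (h ▸ subset_closure ho') ho
  rw [connectedComponentIn_eq this]

theorem six_mul_ncard_le (hA : ∀ L ∈ A, IsLine L)
    {T : Finset ((ℝ × ℝ) × (ℝ × ℝ) × (ℝ × ℝ))} (hT : IsTriSet A T) :
    6 * {F | IsTriangularFace A F}.ncard ≤ T.card := by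
  classical
  set f : (ℝ × ℝ) × (ℝ × ℝ) × (ℝ × ℝ) → Set (ℝ × ℝ) := fun t =>
    convexHull ℝ {t.1, t.2.1, t.2.2} with hf
  have hle : {F | IsTriangularFace A F}.ncard ≤ (T.image f).card := by
    rw [← Set.ncard_coe_finset]
    refine Set.ncard_le_ncard_of_injOn closure ?_ ?_ (Finset.finite_toSet _)
    · intro F hF
      obtain ⟨p, q, r, ht, hc⟩ := exists_tri hA hF
      rw [Finset.mem_coe, Finset.mem_image]
      exact ⟨(p, q, r), (hT _).2 ht, hc.symm⟩
    · intro F hF G hG h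
      exact eq_of_closure_eq hA hF hG h
  refine (Nat.mul_le_mul_left 6 hle).trans (Finset.mul_card_image_le_card T 6 ?_)
  intro S hS
  obtain ⟨⟨p, q, r⟩, ht, rfl⟩ := Finset.mem_image.1 hS
  have ht' := (hT _).1 ht
  simp only at ht'
  have h₁ := ht'.ne₁
  have h₂ := ht'.ne₂
  have h₃ := ht'.ne₃
  have hcard : ({(p, q, r), (q, r, p), (r, p, q), (q, p, r), (p, r, q), (r, q, p)} :
      Finset ((ℝ × ℝ) × (ℝ × ℝ) × (ℝ × ℝ))).card = 6 := by
    repeat rw [Finset.card_insert_of_notMem]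
    · simp
    all_goals
      simp only [Finset.mem_insert, Finset.mem_singleton, Prod.mk.injEq, h₁, h₂, h₃, h₁.symm,
        h₂.symm, h₃.symm, false_and, and_false, or_false, not_false_iff]
  rw [← hcard]
  refine Finset.card_le_card fun t h => ?_
  simp only [Finset.mem_insert, Finset.mem_singleton] at h
  rw [Finset.mem_filter, hT]
  rcases h with rfl | rfl | rfl | rfl | rfl | rfl
  · exact ⟨ht', rfl⟩
  · exact ⟨ht'.rotate, congrArg (convexHull ℝ) (by rw [Set.pair_comm, Set.insert_comm])⟩
  · exact ⟨ht'.rotate.rotate, congrArg (convexHull ℝ) (by rw [Set.insert_comm, Set.pair_comm])⟩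
  · exact ⟨ht'.swap, congrArg (convexHull ℝ) (Set.insert_comm _ _ _)⟩
  · exact ⟨ht'.swap_right, congrArg (convexHull ℝ) (by rw [Set.pair_comm])⟩
  · exact ⟨ht'.swap_right.rotate, congrArg (convexHull ℝ)
      (by rw [Set.insert_comm, Set.pair_comm, Set.insert_comm])⟩

end IsTriangularFace

/-- Clément–Bader upper bound: for `n ≡ 0, 2 (mod 6)`, any arrangement of `n`
lines has at most `⌊n(n-2)/3⌋` triangular faces. -/
theorem clement_bader_bound (n : ℕ) (hn : n % 6 = 0 ∨ n % 6 = 2)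
    (A : Finset (Set (ℝ × ℝ))) (hcard : A.card = n)
    (hlines : ∀ L ∈ A, IsLine L) :
    {F : Set (ℝ × ℝ) | IsTriangularFace A F}.ncard ≤ n * (n - 2) / 3 := by
  obtain ⟨T, hT⟩ := LineArrangement.exists_isTriSet hlines
  have h₁ := IsTriangularFace.six_mul_ncard_le hlines hT
  have h₂ := hT.card_le hlines
  rw [hcard] at h₂
  omega
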